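/- Let f be a continuous function on (0,∞) such that for some 0 < p < γ < q one has limsup_{v→∞} v^{−p}|f(v)| < ∞ and limsup_{v→0⁺} v^{−q}|f(v)| < ∞. Then lim_{ρ→0⁺} F̄_ρ(1)^{−1} ∫_{(0,∞)} f(v) dF_ρ(v) = ∫₀^∞ f(v) γ v^{−γ−1} dv, where the limiting integral is finite. -/

import Mathlib

open MeasureTheory Filter Topology

/-- The generalized inverse of the tail function `a ↦ m (Ioi a)` on `[0, ∞)`. -/
noncomputable def tailQuantile (m : Measure ℝ) (s : ℝ) : ℝ :=
  sInf {a : ℝ | 0 ≤ a ∧ m.real (Set.Ioi a) ≤ s}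

lemma measureReal_Ioi_antitone (m : Measure ℝ) [IsFiniteMeasure m] :
    Antitone fun a : ℝ => m.real (Set.Ioi a) := fun _ _ h =>
  measureReal_mono (Set.Ioi_subset_Ioi h)

lemma measureReal_Ioi_le_of_forall_gt (m : Measure ℝ) [IsFiniteMeasure m] {x s : ℝ}
    (hs : 0 ≤ s) (h : ∀ b > x, m.real (Set.Ioi b) ≤ s) : m.real (Set.Ioi x) ≤ s := by
  obtain ⟨u, hu, hux, hlim⟩ := exists_seq_strictAnti_tendsto x
  have hU : Set.Ioi x = ⋃ n, Set.Ioi (u n) := by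
    ext y
    simp only [Set.mem_Ioi, Set.mem_iUnion]
    exact ⟨fun hy => (hlim.eventually (gt_mem_nhds hy)).exists,
      fun ⟨n, hn⟩ => (hux n).trans hn⟩
  have hm : Monotone fun n => Set.Ioi (u n) := fun i j hij =>
    Set.Ioi_subset_Ioi (hu.antitone hij)
  have key : m (Set.Ioi x) ≤ ENNReal.ofReal s := by
    rw [hU, hm.measure_iUnion]
    exact iSup_le fun n => (ENNReal.le_ofReal_iff_toReal_le (measure_ne_top _ _) hs).2 (h _ (hux n))
  exact ENNReal.toReal_le_of_le_ofReal hs key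

lemma exists_measureReal_Ioi_le (m : Measure ℝ) [IsFiniteMeasure m] {s : ℝ} (hs : 0 < s) :
    ∃ a : ℝ, 0 ≤ a ∧ m.real (Set.Ioi a) ≤ s := by
  have h : Tendsto (fun a : ℝ => m (Set.Ioi a)) atTop (𝓝 (m (⋂ a : ℝ, Set.Ioi a))) :=
    tendsto_measure_iInter_atTop (fun _ => measurableSet_Ioi.nullMeasurableSet)
      (fun _ _ h => Set.Ioi_subset_Ioi h) ⟨0, measure_ne_top _ _⟩
  have he : (⋂ a : ℝ, Set.Ioi a) = ∅ := by
    ext y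
    simpa using ⟨y, le_rfl⟩
  rw [he, measure_empty] at h
  obtain ⟨a, ha, ha0⟩ := ((h.eventually (gt_mem_nhds (ENNReal.ofReal_pos.2 hs))).and
    (eventually_ge_atTop 0)).exists
  exact ⟨a, ha0, ENNReal.toReal_le_of_le_ofReal hs.le ha.le⟩

lemma tailQuantile_nonneg (m : Measure ℝ) (s : ℝ) : 0 ≤ tailQuantile m s :=
  Real.sInf_nonneg fun _ h => h.1

lemma tailQuantile_le_iff (m : Measure ℝ) [IsFiniteMeasure m] {s a : ℝ} (hs : 0 < s)
    (ha : 0 ≤ a) : tailQuantile m s ≤ a ↔ m.real (Set.Ioi a) ≤ s := by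
  have hbdd : BddBelow {a : ℝ | 0 ≤ a ∧ m.real (Set.Ioi a) ≤ s} := ⟨0, fun _ h => h.1⟩
  refine ⟨fun h => ?_, fun h => csInf_le hbdd ⟨ha, h⟩⟩
  refine (measureReal_Ioi_antitone m h).trans
    (measureReal_Ioi_le_of_forall_gt m hs.le fun b hb => ?_)
  obtain ⟨c, hc, hcb⟩ := exists_lt_of_csInf_lt (exists_measureReal_Ioi_le m hs) hb
  exact (measureReal_Ioi_antitone m hcb.le).trans hc.2

lemma lt_tailQuantile_iff (m : Measure ℝ) [IsFiniteMeasure m] {s a : ℝ} (hs : 0 < s)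
    (ha : 0 ≤ a) : a < tailQuantile m s ↔ s < m.real (Set.Ioi a) := by
  simpa using (tailQuantile_le_iff m hs ha).not

lemma aemeasurable_tailQuantile (m : Measure ℝ) [IsFiniteMeasure m] :
    AEMeasurable (tailQuantile m) (volume.restrict (Set.Ioi 0)) := by
  refine aemeasurable_restrict_of_antitoneOn measurableSet_Ioi fun s hs t ht hst => ?_
  rw [tailQuantile_le_iff m ht (tailQuantile_nonneg m s)]
  exact ((tailQuantile_le_iff m hs (tailQuantile_nonneg m s)).1 le_rfl).trans hst

lemma restrict_map_tailQuantile (m : Measure ℝ) [IsFiniteMeasure m] :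
    (Measure.map (tailQuantile m) (volume.restrict (Set.Ioi 0))).restrict (Set.Ioi 0) =
      m.restrict (Set.Ioi 0) := by
  have key : ∀ a : ℝ, (m.restrict (Set.Ioi 0)) (Set.Ioi a) =
      ((Measure.map (tailQuantile m) (volume.restrict (Set.Ioi 0))).restrict (Set.Ioi 0))
        (Set.Ioi a) := by
    intro a
    rw [Measure.restrict_apply measurableSet_Ioi, Measure.restrict_apply measurableSet_Ioi,
      Set.Ioi_inter_Ioi, Measure.map_apply_of_aemeasurable (aemeasurable_tailQuantile m)
        measurableSet_Ioi]
    have ha : 0 ≤ a ⊔ 0 := le_sup_right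
    have h : tailQuantile m ⁻¹' Set.Ioi (a ⊔ 0) ∩ Set.Ioi 0 =
        Set.Ioo 0 (m.real (Set.Ioi (a ⊔ 0))) := by
      ext s
      simp only [Set.mem_inter_iff, Set.mem_preimage, Set.mem_Ioi, Set.mem_Ioo]
      rw [and_comm]
      exact and_congr_right fun hs => lt_tailQuantile_iff m hs ha
    rw [Measure.restrict_apply' measurableSet_Ioi, h, Real.volume_Ioo, sub_zero,
      ofReal_measureReal]
  refine (ext_of_generate_finite _ (BorelSpace.measurable_eq.trans (borel_eq_generateFrom_Ioi ℝ))
    isPiSystem_Ioi (Set.forall_mem_range.2 key) ?_).symm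
  have h0 := key 0
  rwa [Measure.restrict_apply_self, Measure.restrict_apply_self,
    ← Measure.restrict_apply_univ, ← Measure.restrict_apply_univ (Set.Ioi 0)] at h0

lemma setIntegral_Ioi_eq_integral_tailQuantile (m : Measure ℝ) [IsFiniteMeasure m] {f : ℝ → ℝ}
    (hf : ContinuousOn f (Set.Ioi 0)) :
    ∫ v in Set.Ioi (0:ℝ), f v ∂m =
      ∫ s in Set.Ioi (0:ℝ), (Set.Ioi (0:ℝ)).indicator f (tailQuantile m s) := by
  rw [← restrict_map_tailQuantile, ← integral_indicator measurableSet_Ioi,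
    integral_map (aemeasurable_tailQuantile m)]
  exact (aestronglyMeasurable_indicator_iff measurableSet_Ioi).2
    (hf.aestronglyMeasurable measurableSet_Ioi)

lemma aestronglyMeasurable_indicator_tailQuantile (m : Measure ℝ) [IsFiniteMeasure m] {f : ℝ → ℝ}
    (hf : ContinuousOn f (Set.Ioi 0)) :
    AEStronglyMeasurable (fun s => (Set.Ioi (0:ℝ)).indicator f (tailQuantile m s))
      (volume.restrict (Set.Ioi 0)) :=
  AEStronglyMeasurable.comp_aemeasurable
    ((aestronglyMeasurable_indicator_iff measurableSet_Ioi).2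
      (hf.aestronglyMeasurable measurableSet_Ioi)) (aemeasurable_tailQuantile m)

lemma tendsto_tailQuantile {ι : Type*} {l : Filter ι} {m : ι → Measure ℝ}
    [∀ i, IsFiniteMeasure (m i)] {γ : ℝ} (hγ : 0 < γ)
    (h : ∀ a > (0:ℝ), Tendsto (fun i => (m i).real (Set.Ioi a)) l (𝓝 (a ^ (-γ))))
    {s : ℝ} (hs : 0 < s) :
    Tendsto (fun i => tailQuantile (m i) s) l (𝓝 (s ^ (-γ⁻¹))) := by
  have hs' : 0 < s ^ (-γ⁻¹) := Real.rpow_pos_of_pos hs _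
  have hinv : (s ^ (-γ⁻¹)) ^ (-γ) = s := by
    rw [← Real.rpow_mul hs.le, neg_mul_neg, inv_mul_cancel₀ hγ.ne', Real.rpow_one]
  refine tendsto_order.2 ⟨fun a ha => ?_, fun a ha => ?_⟩
  · rcases lt_or_ge 0 a with h0 | h0
    · have : s < a ^ (-γ) := by
        conv_lhs => rw [← hinv]
        exact Real.rpow_lt_rpow_of_neg h0 ha (neg_lt_zero.2 hγ)
      filter_upwards [(h a h0).eventually (lt_mem_nhds this)] with i hi
      exact (lt_tailQuantile_iff _ hs h0.le).2 hi
    · have : s < (s ^ (-γ⁻¹) / 2) ^ (-γ) := by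
        conv_lhs => rw [← hinv]
        exact Real.rpow_lt_rpow_of_neg (half_pos hs') (half_lt_self hs') (neg_lt_zero.2 hγ)
      filter_upwards [(h _ (half_pos hs')).eventually (lt_mem_nhds this)] with i hi
      exact h0.trans_lt ((half_pos hs').trans ((lt_tailQuantile_iff _ hs (half_pos hs').le).2 hi))
  · obtain ⟨b, hb, hba⟩ := exists_between ha
    have hb0 : 0 < b := hs'.trans hb
    have : b ^ (-γ) < s := by
      conv_rhs => rw [← hinv]
      exact Real.rpow_lt_rpow_of_neg hs' hb (neg_lt_zero.2 hγ)
    filter_upwards [(h b hb0).eventually (gt_mem_nhds this)] with i hi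
    exact ((tailQuantile_le_iff _ hs hb0.le).2 hi.le).trans_lt hba

lemma le_rpow_neg_mul_of_doubling {U : ℝ → ℝ} (hU : Antitone U) (hpos : ∀ v, 0 < U v)
    {α V : ℝ} (hα : 0 < α) (hV : 0 < V) (h : ∀ v ≥ V, U (2 * v) ≤ 2 ^ (-α) * U v)
    {v a : ℝ} (hv : V ≤ v) (ha : 1 ≤ a) : U (a * v) ≤ 2 ^ α * a ^ (-α) * U v := by
  have hv0 : 0 < v := hV.trans_le hv
  have hit : ∀ n : ℕ, U (2 ^ n * v) ≤ ((2:ℝ) ^ n) ^ (-α) * U v := by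
    intro n
    induction n with
    | zero => simp
    | succ n ih =>
      have h1 : V ≤ 2 ^ n * v := hv.trans (le_mul_of_one_le_left hv0.le (one_le_pow₀ one_le_two))
      calc U (2 ^ (n + 1) * v) = U (2 * (2 ^ n * v)) := by ring_nf
        _ ≤ 2 ^ (-α) * U (2 ^ n * v) := h _ h1
        _ ≤ 2 ^ (-α) * (((2:ℝ) ^ n) ^ (-α) * U v) := by gcongr
        _ = ((2:ℝ) ^ (n + 1)) ^ (-α) * U v := by
          rw [pow_succ, Real.mul_rpow (by positivity) (by positivity)]; ring
  obtain ⟨n, hn1, hn2⟩ := exists_nat_pow_near ha one_lt_two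
  have ha0 : 0 < a := zero_lt_one.trans_le ha
  calc U (a * v) ≤ U (2 ^ n * v) := hU (by gcongr)
    _ ≤ ((2:ℝ) ^ n) ^ (-α) * U v := hit n
    _ ≤ (a / 2) ^ (-α) * U v := by
      refine mul_le_mul_of_nonneg_right ?_ (hpos v).le
      refine Real.rpow_le_rpow_of_nonpos (half_pos ha0) ?_ (neg_nonpos.2 hα.le)
      rw [pow_succ] at hn2
      linarith
    _ = 2 ^ α * a ^ (-α) * U v := by
      rw [Real.div_rpow ha0.le zero_le_two, Real.rpow_neg zero_le_two α]
      field_simp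

lemma le_rpow_mul_of_doubling {U : ℝ → ℝ} (hU : Antitone U) (hpos : ∀ v, 0 < U v)
    {β V : ℝ} (hβ : 0 < β) (hV : 0 < V) (h : ∀ v ≥ V, U v ≤ 2 ^ β * U (2 * v))
    {v a : ℝ} (hv : V ≤ v) (ha : 1 ≤ a) : U v ≤ 2 ^ β * a ^ β * U (a * v) := by
  have hv0 : 0 < v := hV.trans_le hv
  have hit : ∀ n : ℕ, U v ≤ ((2:ℝ) ^ n) ^ β * U (2 ^ n * v) := by
    intro n
    induction n with
    | zero => simp
    | succ n ih =>
      have h1 : V ≤ 2 ^ n * v := hv.trans (le_mul_of_one_le_left hv0.le (one_le_pow₀ one_le_two))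
      calc U v ≤ ((2:ℝ) ^ n) ^ β * U (2 ^ n * v) := ih
        _ ≤ ((2:ℝ) ^ n) ^ β * (2 ^ β * U (2 * (2 ^ n * v))) := by gcongr; exact h _ h1
        _ = ((2:ℝ) ^ (n + 1)) ^ β * U (2 ^ (n + 1) * v) := by
          rw [pow_succ, Real.mul_rpow (by positivity) (by positivity), mul_assoc,
            mul_comm ((2:ℝ) ^ n) 2, mul_assoc]
  obtain ⟨n, hn1, hn2⟩ := exists_nat_pow_near ha one_lt_two
  have ha0 : 0 < a := zero_lt_one.trans_le ha
  calc U v ≤ ((2:ℝ) ^ (n + 1)) ^ β * U (2 ^ (n + 1) * v) := hit _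
    _ ≤ (2 * a) ^ β * U (a * v) := by
      have h1 : U (2 ^ (n + 1) * v) ≤ U (a * v) := hU (by gcongr)
      have h2 : (2:ℝ) ^ (n + 1) ≤ 2 * a := by rw [pow_succ]; linarith
      have := (hpos (2 ^ (n + 1) * v)).le
      gcongr
    _ = 2 ^ β * a ^ β * U (a * v) := by rw [Real.mul_rpow zero_le_two ha0.le]

/-- Potter-type bounds for a bounded regularly varying tail function. -/
lemma exists_potter_bound {U : ℝ → ℝ} (hU : Antitone U) (hpos : ∀ v, 0 < U v)
    (hle : ∀ v, U v ≤ 1) {γ α β : ℝ} (hα : 0 < α) (hαγ : α < γ) (hγβ : γ < β)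
    (h : Tendsto (fun v => U (2 * v) / U v) atTop (𝓝 (2 ^ (-γ)))) :
    ∃ C > 0, ∀ᶠ v in atTop, (∀ a ≥ 1, U (a * v) ≤ C * a ^ (-α) * U v) ∧
      ∀ a > 0, a ≤ 1 → U (a * v) ≤ C * a ^ (-β) * U v := by
  have hβ : 0 < β := hα.trans (hαγ.trans hγβ)
  have h1 : (2:ℝ) ^ (-γ) < 2 ^ (-α) := Real.rpow_lt_rpow_of_exponent_lt one_lt_two (by linarith)
  have h2 : (2:ℝ) ^ (-β) < 2 ^ (-γ) := Real.rpow_lt_rpow_of_exponent_lt one_lt_two (by linarith)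
  obtain ⟨V, hV⟩ := eventually_atTop.1 (((h.eventually (gt_mem_nhds h1)).and
    (h.eventually (lt_mem_nhds h2))).and (eventually_gt_atTop 0))
  have hV0 : 0 < V := (hV V le_rfl).2
  have hup : ∀ v ≥ V, U (2 * v) ≤ 2 ^ (-α) * U v := fun v hv =>
    ((div_lt_iff₀ (hpos v)).1 (hV v hv).1.1).le
  have hlo : ∀ v ≥ V, U v ≤ 2 ^ β * U (2 * v) := fun v hv => by
    have := (lt_div_iff₀ (hpos v)).1 (hV v hv).1.2
    rw [Real.rpow_neg zero_le_two, inv_mul_lt_iff₀ (by positivity)] at this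
    exact this.le
  have hUV := hpos V
  refine ⟨2 ^ β / U V, by positivity, ?_⟩
  have hC : (2:ℝ) ^ β ≤ 2 ^ β / U V := by
    rw [le_div_iff₀ hUV]
    exact mul_le_of_le_one_right (by positivity) (hle V)
  filter_upwards [eventually_ge_atTop V] with v hv
  have hv0 : 0 < v := hV0.trans_le hv
  have hUv := hpos v
  refine ⟨fun a ha => ?_, fun a ha ha1 => ?_⟩
  · refine (le_rpow_neg_mul_of_doubling hU hpos hα hV0 hup hv ha).trans ?_
    have : (2:ℝ) ^ α ≤ 2 ^ β / U V :=
      (Real.rpow_le_rpow_of_exponent_le one_le_two (hαγ.trans hγβ).le).trans hC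
    gcongr
  · rcases le_total V (a * v) with hav | hav
    · have := le_rpow_mul_of_doubling hU hpos hβ hV0 hlo hav ((one_le_inv₀ ha).2 ha1)
      rw [inv_mul_cancel_left₀ ha.ne', Real.inv_rpow ha.le, ← Real.rpow_neg ha.le] at this
      refine this.trans ?_
      gcongr
    · have := le_rpow_mul_of_doubling hU hpos hβ hV0 hlo le_rfl ((one_le_div hV0).2 hv)
      rw [div_mul_cancel₀ _ hV0.ne'] at this
      have h3 : (v / V) ^ β ≤ a ^ (-β) := by
        rw [Real.rpow_neg ha.le, ← Real.inv_rpow ha.le]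
        refine Real.rpow_le_rpow (by positivity) ?_ hβ.le
        rw [div_le_iff₀ hV0, inv_mul_eq_div, le_div_iff₀ ha]
        linarith
      calc U (a * v) ≤ 1 := hle _
        _ ≤ (2 ^ β * (v / V) ^ β * U v) / U V := (one_le_div hUV).2 this
        _ ≤ (2 ^ β * a ^ (-β) * U v) / U V := by gcongr
        _ = 2 ^ β / U V * a ^ (-β) * U v := by ring

lemma exists_forall_le_of_continuousOn_Ioi {h : ℝ → ℝ} (hc : ContinuousOn h (Set.Ioi 0))
    {A B : ℝ} (htop : ∀ᶠ v in atTop, h v ≤ A) (hzero : ∀ᶠ v in 𝓝[>] (0:ℝ), h v ≤ B) :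
    ∃ K ≥ 0, ∀ v > 0, h v ≤ K := by
  obtain ⟨M, hM⟩ := eventually_atTop.1 htop
  obtain ⟨δ, hδ0, hδ⟩ := mem_nhdsGT_iff_exists_Ioo_subset.1 hzero
  obtain ⟨D, hD⟩ := (isCompact_Icc (a := δ) (b := M)).bddAbove_image
    (hc.mono fun x hx => lt_of_lt_of_le hδ0 hx.1)
  refine ⟨max 0 (max A (max B D)), le_max_left _ _, fun v hv => ?_⟩
  rcases lt_or_ge v δ with h1 | h1
  · exact (hδ ⟨hv, h1⟩ : h v ≤ B).trans (by simp)
  · rcases le_total M v with h2 | h2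
    · exact (hM v h2).trans (by simp)
    · exact (hD (Set.mem_image_of_mem h ⟨h1, h2⟩)).trans (by simp)

lemma exists_abs_le_rpow {f : ℝ → ℝ} {p q : ℝ} (hpq : p ≤ q) (hf : ContinuousOn f (Set.Ioi 0))
    (htop : IsBoundedUnder (· ≤ ·) atTop (fun v : ℝ => v ^ (-p) * |f v|))
    (hzero : IsBoundedUnder (· ≤ ·) (𝓝[>] (0:ℝ)) (fun v : ℝ => v ^ (-q) * |f v|)) :
    ∃ K ≥ 0, ∀ v > 0, |f v| ≤ K * v ^ p ∧ |f v| ≤ K * v ^ q := by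
  obtain ⟨A, hA⟩ := htop
  obtain ⟨B, hB⟩ := hzero
  rw [eventually_map] at hA hB
  have hc : ∀ r : ℝ, ContinuousOn (fun v : ℝ => v ^ r * |f v|) (Set.Ioi 0) := fun r =>
    (continuousOn_id.rpow_const fun x hx => Or.inl (ne_of_gt hx)).mul hf.abs
  have hBp : ∀ᶠ v in 𝓝[>] (0:ℝ), v ^ (-p) * |f v| ≤ B := by
    filter_upwards [hB, Ioo_mem_nhdsGT one_pos] with v hv h1
    exact (mul_le_mul_of_nonneg_right (Real.rpow_le_rpow_of_exponent_ge h1.1 h1.2.le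
      (neg_le_neg hpq)) (abs_nonneg _)).trans hv
  have hAq : ∀ᶠ v : ℝ in atTop, v ^ (-q) * |f v| ≤ A := by
    filter_upwards [hA, eventually_ge_atTop 1] with v hv h1
    exact (mul_le_mul_of_nonneg_right (Real.rpow_le_rpow_of_exponent_le h1
      (neg_le_neg hpq)) (abs_nonneg _)).trans hv
  obtain ⟨K, hK0, hK⟩ := exists_forall_le_of_continuousOn_Ioi (hc _) hA hBp
  obtain ⟨L, hL0, hL⟩ := exists_forall_le_of_continuousOn_Ioi (hc _) hAq hB
  have key : ∀ v > 0, ∀ r D : ℝ, v ^ (-r) * |f v| ≤ D → |f v| ≤ D * v ^ r := by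
    intro v hv r D h
    rwa [Real.rpow_neg hv.le, inv_mul_le_iff₀ (Real.rpow_pos_of_pos hv r), mul_comm] at h
  exact ⟨max K L, le_max_of_le_left hK0, fun v hv =>
    ⟨key v hv p _ ((hK v hv).trans (le_max_left _ _)),
      key v hv q _ ((hL v hv).trans (le_max_right _ _))⟩⟩

/-- A function equal to a power of exponent `r > -1` on `(0, c]` and to a power of exponent
`t < -1` beyond `c`, up to constants, is integrable on `(0, ∞)`. -/
lemma integrableOn_Ioi_ite_rpow {c : ℝ} (hc : 0 < c) {r t : ℝ} (hr : -1 < r) (ht : t < -1)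
    (A B : ℝ) :
    IntegrableOn (fun s : ℝ => if s ≤ c then A * s ^ r else B * s ^ t) (Set.Ioi 0) := by
  rw [← Set.Ioc_union_Ioi_eq_Ioi hc.le]
  refine IntegrableOn.union ?_ ?_
  · have h : IntegrableOn (fun s : ℝ => A * s ^ r) (Set.Ioc 0 c) :=
      ((intervalIntegrable_iff_integrableOn_Ioc_of_le hc.le).1
        (intervalIntegral.intervalIntegrable_rpow' hr)).const_mul A
    exact h.congr_fun (fun s hs => (if_pos hs.2).symm) measurableSet_Ioc
  · have h : IntegrableOn (fun s : ℝ => B * s ^ t) (Set.Ioi c) :=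
      (integrableOn_Ioi_rpow_of_lt ht hc).const_mul B
    exact h.congr_fun (fun s hs => (if_neg (not_le.2 hs)).symm) measurableSet_Ioi

lemma integrableOn_Ioi_mul_rpow {f : ℝ → ℝ} (hf : ContinuousOn f (Set.Ioi 0)) {γ p q K : ℝ}
    (hγ : 0 < γ) (hpγ : p < γ) (hγq : γ < q)
    (hK : ∀ v > 0, |f v| ≤ K * v ^ p ∧ |f v| ≤ K * v ^ q) :
    IntegrableOn (fun v : ℝ => f v * (γ * v ^ (-γ - 1))) (Set.Ioi 0) := by
  have hdom := integrableOn_Ioi_ite_rpow one_pos (r := q + (-γ - 1)) (t := p + (-γ - 1))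
    (by linarith) (by linarith) (K * γ) (K * γ)
  refine Integrable.mono' hdom ?_ ?_
  · refine ContinuousOn.aestronglyMeasurable (hf.mul (continuousOn_const.mul ?_)) measurableSet_Ioi
    exact continuousOn_id.rpow_const fun x hx => Or.inl (ne_of_gt hx)
  · refine (ae_restrict_iff' measurableSet_Ioi).2 (ae_of_all _ fun v (hv : 0 < v) => ?_)
    have hw : 0 ≤ γ * v ^ (-γ - 1) := by positivity
    rw [Real.norm_eq_abs, abs_mul, abs_of_nonneg hw]
    split_ifs
    · rw [Real.rpow_add hv]
      exact (mul_le_mul_of_nonneg_right (hK v hv).2 hw).trans_eq (by ring)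
    · rw [Real.rpow_add hv]
      exact (mul_le_mul_of_nonneg_right (hK v hv).1 hw).trans_eq (by ring)

lemma integral_Ioi_mul_rpow_eq (f : ℝ → ℝ) {γ : ℝ} (hγ : 0 < γ) :
    ∫ v in Set.Ioi (0:ℝ), f v * (γ * v ^ (-γ - 1)) = ∫ s in Set.Ioi (0:ℝ), f (s ^ (-γ⁻¹)) := by
  rw [← integral_comp_rpow_Ioi (fun s => f (s ^ (-γ⁻¹))) (neg_ne_zero.2 hγ.ne')]
  refine setIntegral_congr_fun measurableSet_Ioi fun v (hv : 0 < v) => ?_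
  have : (v ^ (-γ)) ^ (-γ⁻¹) = v := by
    rw [← Real.rpow_mul hv.le, neg_mul_neg, mul_inv_cancel₀ hγ.ne', Real.rpow_one]
  simp only [this, abs_neg, abs_of_pos hγ, smul_eq_mul]
  ring

/-- A power tail bound gives a power bound for functions of the quantile. -/
lemma indicator_tailQuantile_le (m : Measure ℝ) [IsFiniteMeasure m] {f : ℝ → ℝ} {C K r α s : ℝ}
    (hC : 0 < C) (hK : 0 ≤ K) (hr : 0 < r) (hα : 0 < α) (hs : 0 < s)
    (hf : ∀ v > 0, |f v| ≤ K * v ^ r)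
    (hm : m.real (Set.Ioi ((C / s) ^ α⁻¹)) ≤ C * ((C / s) ^ α⁻¹) ^ (-α)) :
    ‖(Set.Ioi (0:ℝ)).indicator f (tailQuantile m s)‖ ≤ K * C ^ (r / α) * s ^ (-(r / α)) := by
  have hCs : 0 < C / s := by positivity
  have hX : tailQuantile m s ≤ (C / s) ^ α⁻¹ := by
    rw [tailQuantile_le_iff m hs (by positivity)]
    refine hm.trans_eq ?_
    rw [← Real.rpow_mul hCs.le, mul_neg, inv_mul_cancel₀ hα.ne', Real.rpow_neg_one]
    field_simp
  by_cases h0 : 0 < tailQuantile m s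
  · rw [Set.indicator_of_mem (Set.mem_Ioi.2 h0), Real.norm_eq_abs]
    calc |f (tailQuantile m s)| ≤ K * tailQuantile m s ^ r := hf _ h0
      _ ≤ K * ((C / s) ^ α⁻¹) ^ r := by gcongr
      _ = K * C ^ (r / α) * s ^ (-(r / α)) := by
        rw [← Real.rpow_mul hCs.le, inv_mul_eq_div, Real.div_rpow hC.le hs.le, Real.rpow_neg hs.le]
        ring
  · rw [Set.indicator_of_notMem (by simpa using h0), norm_zero]
    positivity

theorem regvar_limit
    (γ : ℝ) (hγ : 0 < γ)
    (μ : Measure ℝ) [IsProbabilityMeasure μ]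
    (hsupp : μ (Set.Iio 0) = 0)
    (hpos : ∀ v : ℝ, 0 < μ (Set.Ioi v))
    (hreg : ∀ a > (0:ℝ), Tendsto
      (fun v : ℝ => (μ (Set.Ioi (a * v))).toReal / (μ (Set.Ioi v)).toReal)
      atTop (𝓝 (a ^ (-γ))))
    (f : ℝ → ℝ) (p q : ℝ) (hp : 0 < p) (hpγ : p < γ) (hγq : γ < q)
    (hf : ContinuousOn f (Set.Ioi 0))
    (hbound_top : IsBoundedUnder (· ≤ ·) atTop (fun v : ℝ => v ^ (-p) * |f v|))
    (hbound_zero : IsBoundedUnder (· ≤ ·) (𝓝[>] (0:ℝ)) (fun v : ℝ => v ^ (-q) * |f v|)) :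
    IntegrableOn (fun v : ℝ => f v * (γ * v ^ (-γ - 1))) (Set.Ioi 0) ∧
    Tendsto
      (fun ρ : ℝ => ((μ (Set.Ioi ρ⁻¹)).toReal)⁻¹ *
        ∫ v in Set.Ioi (0:ℝ), f v ∂(Measure.map (fun x => ρ * x) μ))
      (𝓝[>] (0:ℝ))
      (𝓝 (∫ v in Set.Ioi (0:ℝ), f v * (γ * v ^ (-γ - 1)))) := by
  obtain ⟨K, hK0, hK⟩ := exists_abs_le_rpow (hpγ.trans hγq).le hf hbound_top hbound_zero
  refine ⟨integrableOn_Ioi_mul_rpow hf hγ hpγ hγq hK, ?_⟩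
  obtain ⟨α, hpα, hαγ⟩ := exists_between hpγ
  obtain ⟨β, hγβ, hβq⟩ := exists_between hγq
  have hα : 0 < α := hp.trans hpα
  have hβ : 0 < β := hγ.trans hγβ
  have hUpos : ∀ v, 0 < μ.real (Set.Ioi v) := fun v =>
    ENNReal.toReal_pos (hpos v).ne' (measure_ne_top _ _)
  obtain ⟨C, hC, hpotter⟩ := exists_potter_bound (measureReal_Ioi_antitone μ) hUpos
    (fun _ => measureReal_le_one) hα hαγ hγβ (hreg 2 two_pos)
  set m : ℝ → Measure ℝ := fun ρ =>
    (μ (Set.Ioi ρ⁻¹))⁻¹ • Measure.map (fun x => ρ * x) μ with hm_def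
  have hfin : ∀ ρ, IsFiniteMeasure (m ρ) := fun ρ =>
    Measure.smul_finite _ (ENNReal.inv_ne_top.2 (hpos _).ne')
  have hm : ∀ ρ > 0, ∀ a, (m ρ).real (Set.Ioi a) =
      μ.real (Set.Ioi (a * ρ⁻¹)) / μ.real (Set.Ioi ρ⁻¹) := by
    intro ρ hρ a
    have hpre : (fun x => ρ * x) ⁻¹' Set.Ioi a = Set.Ioi (a * ρ⁻¹) := by
      ext x
      simp only [Set.mem_preimage, Set.mem_Ioi]
      rw [← div_eq_mul_inv, div_lt_iff₀ hρ, mul_comm]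
    rw [measureReal_def, hm_def, Measure.smul_apply,
      Measure.map_apply (measurable_const_mul ρ) measurableSet_Ioi, hpre, smul_eq_mul,
      ENNReal.toReal_mul, ENNReal.toReal_inv, div_eq_inv_mul]
    rfl
  have hmlim : ∀ a > (0:ℝ), Tendsto (fun ρ => (m ρ).real (Set.Ioi a)) (𝓝[>] (0:ℝ))
      (𝓝 (a ^ (-γ))) := fun a ha =>
    ((hreg a ha).comp tendsto_inv_nhdsGT_zero).congr' (by
      filter_upwards [self_mem_nhdsWithin] with ρ hρ using (hm ρ hρ a).symm)
  have hint : ∀ ρ, ((μ (Set.Ioi ρ⁻¹)).toReal)⁻¹ *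
      ∫ v in Set.Ioi (0:ℝ), f v ∂(Measure.map (fun x => ρ * x) μ) =
      ∫ s in Set.Ioi (0:ℝ), (Set.Ioi (0:ℝ)).indicator f (tailQuantile (m ρ) s) := by
    intro ρ
    rw [← setIntegral_Ioi_eq_integral_tailQuantile (m ρ) hf, hm_def, Measure.restrict_smul,
      integral_smul_measure, ENNReal.toReal_inv, smul_eq_mul]
  simp only [hint]
  rw [integral_Ioi_mul_rpow_eq f hγ]
  refine tendsto_integral_filter_of_dominated_convergence
    (fun s => if s ≤ C then K * C ^ (p / α) * s ^ (-(p / α)) else K * C ^ (q / β) * s ^ (-(q / β)))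
    (Eventually.of_forall fun ρ => aestronglyMeasurable_indicator_tailQuantile (m ρ) hf) ?_ ?_ ?_
  · filter_upwards [tendsto_inv_nhdsGT_zero.eventually hpotter, self_mem_nhdsWithin] with ρ hρ hρ0
    refine (ae_restrict_iff' measurableSet_Ioi).2 (ae_of_all _ fun s (hs : 0 < s) => ?_)
    split_ifs with hsC
    · refine indicator_tailQuantile_le (m ρ) hC hK0 hp hα hs (fun v hv => (hK v hv).1) ?_
      rw [hm ρ hρ0, div_le_iff₀ (hUpos _)]
      exact hρ.1 _ (Real.one_le_rpow ((one_le_div hs).2 hsC) (inv_nonneg.2 hα.le))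
    · refine indicator_tailQuantile_le (m ρ) hC hK0 (hγ.trans hγq) hβ hs
        (fun v hv => (hK v hv).2) ?_
      rw [hm ρ hρ0, div_le_iff₀ (hUpos _)]
      exact hρ.2 _ (by positivity) (Real.rpow_le_one (by positivity)
        ((div_le_one hs).2 (not_le.1 hsC).le) (inv_nonneg.2 hβ.le))
  · exact integrableOn_Ioi_ite_rpow hC (neg_lt_neg ((div_lt_one hα).2 hpα))
      (neg_lt_neg ((one_lt_div hβ).2 hβq)) _ _
  · refine (ae_restrict_iff' measurableSet_Ioi).2 (ae_of_all _ fun s (hs : 0 < s) => ?_)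
    have hpos' : 0 < s ^ (-γ⁻¹) := Real.rpow_pos_of_pos hs _
    have hX := tendsto_tailQuantile hγ hmlim hs
    refine ((hf.continuousAt (Ioi_mem_nhds hpos')).tendsto.comp hX).congr' ?_
    filter_upwards [hX.eventually (lt_mem_nhds hpos')] with ρ hρ
    exact (Set.indicator_of_mem (Set.mem_Ioi.2 hρ) f).symm
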